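/- The quantum cost operator C = |x−y|² + |ℏD_x − ℏD_y|² on L²(ℝᵈ × ℝᵈ) satisfies the Heisenberg-type lower bound C ≥ 2dℏ · I, and the one-sided cost c(x,ξ) = |x−z|² + |ξ − ℏD_z|² on L²(ℝᵈ) satisfies c(x,ξ) ≥ dℏ · I for every (x,ξ) ∈ ℝ^{2d}, in the sense of quadratic forms. -/

import Mathlib

open MeasureTheory

/-- Quadratic form of the one-sided cost `c(x,ξ) = |x−z|² + |ξ − ℏD_z|²` on `L²(ℝᵈ)`. -/
noncomputable def costForm (d : ℕ) (hbar : ℝ) (x ξ : Fin d → ℝ)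
    (ψ : (Fin d → ℝ) → ℂ) : ENNReal :=
  (∫⁻ z, ENNReal.ofReal ((∑ j, (x j - z j) ^ 2) * ‖ψ z‖ ^ 2)) +
    ∫⁻ z, ENNReal.ofReal
      (∑ j, ‖(ξ j : ℂ) * ψ z + Complex.I * (hbar : ℂ) * fderiv ℝ ψ z (Pi.single j 1)‖ ^ 2)

/-- Quadratic form of the two-sided quantum cost
`C = |x−y|² + |ℏD_x − ℏD_y|²` on `L²(ℝᵈ × ℝᵈ)`. -/
noncomputable def quantumCostForm (d : ℕ) (hbar : ℝ)
    (Ψ : (Fin d → ℝ) × (Fin d → ℝ) → ℂ) : ENNReal :=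
  (∫⁻ p, ENNReal.ofReal ((∑ j, (p.1 j - p.2 j) ^ 2) * ‖Ψ p‖ ^ 2)) +
    ∫⁻ p, ENNReal.ofReal
      (∑ j, hbar ^ 2 *
        ‖fderiv ℝ Ψ p (Pi.single j 1, 0) - fderiv ℝ Ψ p (0, Pi.single j 1)‖ ^ 2)

lemma abs_mul_inner_le_costDensity (s h ξ : ℝ) (z w : ℂ) :
    |h * (s * (2 * inner ℝ z w))| ≤
      s ^ 2 * ‖z‖ ^ 2 + ‖(ξ : ℂ) * z + Complex.I * (h : ℂ) * w‖ ^ 2 := by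
  have hz : ‖z‖ ^ 2 = z.re ^ 2 + z.im ^ 2 := by
    rw [Complex.sq_norm, Complex.normSq_apply]; ring
  have hw : ‖(ξ : ℂ) * z + Complex.I * (h : ℂ) * w‖ ^ 2 =
      (ξ * z.re - h * w.im) ^ 2 + (ξ * z.im + h * w.re) ^ 2 := by
    rw [Complex.sq_norm, Complex.normSq_apply]; simp; ring
  have hi : inner ℝ z w = z.re * w.re + z.im * w.im := by
    simp [Complex.inner]; ring
  rw [hz, hw, hi, abs_le]
  constructor
  · linear_combination sq_nonneg (s * z.re + (ξ * z.im + h * w.re)) +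
      sq_nonneg (s * z.im - (ξ * z.re - h * w.im))
  · linear_combination sq_nonneg (s * z.re - (ξ * z.im + h * w.re)) +
      sq_nonneg (s * z.im + (ξ * z.re - h * w.im))

/-- The one-dimensional uncertainty inequality, without any integrability hypothesis. -/
lemma lintegral_norm_sq_le_lintegral_costDensity {f : ℝ → ℂ} (hf : Differentiable ℝ f)
    {h : ℝ} (hh : 0 < h) (a ξ : ℝ) :
    ∫⁻ t, ENNReal.ofReal (h * ‖f t‖ ^ 2) ≤
      ∫⁻ t, ENNReal.ofReal ((a - t) ^ 2 * ‖f t‖ ^ 2 +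
        ‖(ξ : ℂ) * f t + Complex.I * (h : ℂ) * deriv f t‖ ^ 2) := by
  set G : ℝ → ℝ := fun t => (a - t) ^ 2 * ‖f t‖ ^ 2 +
    ‖(ξ : ℂ) * f t + Complex.I * (h : ℂ) * deriv f t‖ ^ 2 with hG
  have hfc : Continuous f := hf.continuous
  have hGm : Measurable G := by
    have := measurable_deriv f
    have := hfc.measurable
    fun_prop
  have hG0 : ∀ t, 0 ≤ G t := fun t => by positivity
  by_cases hGi : Integrable G
  swap
  · have htop : ∫⁻ t, ENNReal.ofReal (G t) = ⊤ := by
      by_contra hne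
      exact hGi ((lintegral_ofReal_ne_top_iff_integrable hGm.aestronglyMeasurable
        (Filter.Eventually.of_forall hG0)).1 hne)
    rw [htop]
    exact le_top
  have hwt : ∀ t, (a - t) ^ 2 * ‖f t‖ ^ 2 ≤ G t := fun t =>
    le_add_of_nonneg_right (by positivity)
  have hfi : Integrable fun t => ‖f t‖ ^ 2 := by
    have hloc : IntegrableOn (fun t => ‖f t‖ ^ 2) (Set.Icc (a - 1) (a + 1)) :=
      (hfc.norm.pow 2).continuousOn.integrableOn_compact isCompact_Icc
    refine ((hloc.integrable_indicator measurableSet_Icc).add hGi).mono'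
      (hfc.norm.pow 2).aestronglyMeasurable (Filter.Eventually.of_forall fun t => ?_)
    rw [Real.norm_of_nonneg (by positivity), Pi.add_apply]
    by_cases ht : t ∈ Set.Icc (a - 1) (a + 1)
    · rw [Set.indicator_of_mem ht]
      linarith [hG0 t]
    · rw [Set.indicator_of_notMem ht, zero_add]
      refine le_trans (le_mul_of_one_le_left (by positivity) ?_) (hwt t)
      rw [Set.mem_Icc, not_and_or, not_le, not_le] at ht
      rcases ht with ht | ht <;> nlinarith
  set u : ℝ → ℝ := fun t => (t - a) * ‖f t‖ ^ 2 with hu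
  set u' : ℝ → ℝ := fun t => ‖f t‖ ^ 2 + (t - a) * (2 * inner ℝ (f t) (deriv f t)) with hu'
  have hder : ∀ t, HasDerivAt u (u' t) t := fun t => by
    have := ((hasDerivAt_id' t).sub_const a).mul (hf t).hasDerivAt.norm_sq
    rw [one_mul] at this
    exact this
  have hui : Integrable u := by
    refine (hfi.add hGi).mono' (by fun_prop) (Filter.Eventually.of_forall fun t => ?_)
    rw [Pi.add_apply, Real.norm_eq_abs, abs_mul, abs_of_nonneg (sq_nonneg ‖f t‖)]
    have h1 : |t - a| ≤ 1 + (a - t) ^ 2 := by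
      rw [abs_le]
      constructor <;> nlinarith [sq_nonneg (a - t - 1), sq_nonneg (a - t + 1)]
    nlinarith [hwt t, mul_le_mul_of_nonneg_right h1 (sq_nonneg ‖f t‖)]
  have hpt : ∀ t, |h * ((t - a) * (2 * inner ℝ (f t) (deriv f t)))| ≤ G t := fun t => by
    have := abs_mul_inner_le_costDensity (t - a) h ξ (f t) (deriv f t)
    rwa [sub_sq_comm] at this
  have hu'i : Integrable u' := by
    have hmeas : Measurable u' := by
      have := measurable_deriv f
      have := hfc.measurable
      fun_prop
    refine (hfi.add (hGi.const_mul h⁻¹)).mono' hmeas.aestronglyMeasurable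
      (Filter.Eventually.of_forall fun t => ?_)
    rw [Pi.add_apply, Real.norm_eq_abs]
    refine (abs_add_le _ _).trans (add_le_add (abs_of_nonneg (by positivity)).le ?_)
    have := hpt t
    rw [abs_mul, abs_of_pos hh] at this
    rwa [le_inv_mul_iff₀ hh]
  have hzero : ∫ t, u' t = 0 := integral_eq_zero_of_hasDerivAt_of_integrable hder hu'i hui
  have hle : ∫ t, h * ‖f t‖ ^ 2 ≤ ∫ t, (G t + h * u' t) := by
    refine integral_mono (hfi.const_mul h) (hGi.add (hu'i.const_mul h)) fun t => ?_
    have := (abs_le.1 (hpt t)).1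
    simp only [hu', mul_add]
    linarith
  rw [integral_add hGi (hu'i.const_mul h), integral_const_mul h u', hzero, mul_zero,
    add_zero] at hle
  rw [← ofReal_integral_eq_lintegral_ofReal (hfi.const_mul h)
      (Filter.Eventually.of_forall fun t => by positivity),
    ← ofReal_integral_eq_lintegral_ofReal hGi (Filter.Eventually.of_forall hG0)]
  exact ENNReal.ofReal_le_ofReal hle

section Lines

variable {E : Type*} [NormedAddCommGroup E] [NormedSpace ℝ E] [MeasurableSpace E]
  [BorelSpace E] [SecondCountableTopology E] {μ : Measure E} [SFinite μ]
  [μ.IsAddLeftInvariant]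

/-- Disintegration of an invariant measure along the lines of direction `v`; the base points
range over the slab `0 ≤ l < 1`. -/
lemma lintegral_eq_lintegral_slab_lines {l : E →L[ℝ] ℝ} {v : E} (hlv : l v = 1)
    {F : E → ENNReal} (hF : Measurable F) :
    ∫⁻ p, F p ∂μ = ∫⁻ p in l ⁻¹' Set.Ico 0 1, (∫⁻ t : ℝ, F (p + t • v)) ∂μ := by
  have hS : MeasurableSet (l ⁻¹' Set.Ico (0 : ℝ) 1) := l.measurable measurableSet_Ico
  set φ : E → ENNReal := (l ⁻¹' Set.Ico (0 : ℝ) 1).indicator 1 with hφ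
  have hφm : Measurable φ := measurable_one.indicator hS
  have hline : ∀ q, ∫⁻ t : ℝ, φ (q - t • v) = 1 := fun q => by
    have : (fun t : ℝ => φ (q - t • v)) = (Set.Ioc (l q - 1) (l q)).indicator 1 := by
      funext t
      have hmem : q - t • v ∈ l ⁻¹' Set.Ico (0 : ℝ) 1 ↔ t ∈ Set.Ioc (l q - 1) (l q) := by
        simp only [Set.mem_preimage, map_sub, map_smul, hlv, smul_eq_mul, mul_one, Set.mem_Ico,
          Set.mem_Ioc]
        constructor <;> rintro ⟨h1, h2⟩ <;> constructor <;> linarith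
      by_cases ht : t ∈ Set.Ioc (l q - 1) (l q)
      · rw [hφ, Set.indicator_of_mem (hmem.2 ht), Set.indicator_of_mem ht]
        rfl
      · rw [hφ, Set.indicator_of_notMem (mt hmem.1 ht), Set.indicator_of_notMem ht]
    rw [this, lintegral_indicator_one measurableSet_Ioc, Real.volume_Ioc]
    simp
  calc ∫⁻ p, F p ∂μ = ∫⁻ p, (∫⁻ t : ℝ, F p * φ (p - t • v)) ∂μ := by
        refine lintegral_congr fun p => ?_
        rw [lintegral_const_mul _ (by fun_prop), hline, mul_one]
    _ = ∫⁻ t : ℝ, (∫⁻ p, F p * φ (p - t • v) ∂μ) :=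
        lintegral_lintegral_swap (by fun_prop)
    _ = ∫⁻ t : ℝ, (∫⁻ p, φ p * F (p + t • v) ∂μ) := by
        refine lintegral_congr fun t => ?_
        rw [← lintegral_add_left_eq_self _ (t • v)]
        refine lintegral_congr fun p => ?_
        rw [add_comm (t • v), add_sub_cancel_right, mul_comm]
    _ = ∫⁻ p, (∫⁻ t : ℝ, φ p * F (p + t • v)) ∂μ :=
        lintegral_lintegral_swap (by fun_prop)
    _ = ∫⁻ p in l ⁻¹' Set.Ico 0 1, (∫⁻ t : ℝ, F (p + t • v)) ∂μ := by
        rw [← lintegral_indicator hS]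
        refine lintegral_congr fun p => ?_
        rw [lintegral_const_mul _ (by fun_prop)]
        by_cases hp : p ∈ l ⁻¹' Set.Ico (0 : ℝ) 1 <;> simp [hφ, hp]

/-- The uncertainty inequality for the position `l` and the momentum along `v`, where
`l v = 1`. -/
lemma lintegral_norm_sq_le_directional {l : E →L[ℝ] ℝ} {v : E} (hlv : l v = 1)
    {h : ℝ} (hh : 0 < h) (a ξ : ℝ) {ψ : E → ℂ} (hψ : Differentiable ℝ ψ) :
    ∫⁻ p, ENNReal.ofReal (h * ‖ψ p‖ ^ 2) ∂μ ≤
      ∫⁻ p, ENNReal.ofReal ((a - l p) ^ 2 * ‖ψ p‖ ^ 2 +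
        ‖(ξ : ℂ) * ψ p + Complex.I * (h : ℂ) * fderiv ℝ ψ p v‖ ^ 2) ∂μ := by
  have hψm : Measurable ψ := hψ.continuous.measurable
  have hDm : Measurable fun p => fderiv ℝ ψ p v := measurable_fderiv_apply_const ℝ ψ v
  rw [lintegral_eq_lintegral_slab_lines (μ := μ) hlv
      (F := fun p => ENNReal.ofReal (h * ‖ψ p‖ ^ 2)) (by fun_prop),
    lintegral_eq_lintegral_slab_lines (μ := μ) hlv
      (F := fun p => ENNReal.ofReal ((a - l p) ^ 2 * ‖ψ p‖ ^ 2 +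
        ‖(ξ : ℂ) * ψ p + Complex.I * (h : ℂ) * fderiv ℝ ψ p v‖ ^ 2)) (by fun_prop)]
  refine lintegral_mono fun p => ?_
  have hder : ∀ t : ℝ, HasDerivAt (fun s : ℝ => ψ (p + s • v)) (fderiv ℝ ψ (p + t • v) v) t :=
    fun t => by
      have hline : HasDerivAt (fun s : ℝ => p + s • v) v t := by
        simpa using ((hasDerivAt_id t).smul_const v).const_add p
      exact (hψ _).hasFDerivAt.comp_hasDerivAt t hline
  have := lintegral_norm_sq_le_lintegral_costDensity
    (fun t => (hder t).differentiableAt) hh (a - l p) ξ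
  simpa only [(hder _).deriv, map_add, map_smul, hlv, smul_eq_mul, mul_one, sub_sub] using this

end Lines

lemma ofReal_nat_mul_lintegral_le {E : Type*} [MeasurableSpace E] {μ : Measure E} {d : ℕ}
    {c : ℝ} (hc : 0 ≤ c) {g : E → ℝ} (hg : Measurable g) {A B : Fin d → E → ℝ}
    (hA : ∀ j, Measurable (A j)) (hB : ∀ j, Measurable (B j))
    (hA0 : ∀ j p, 0 ≤ A j p) (hB0 : ∀ j p, 0 ≤ B j p)
    (hle : ∀ j, ∫⁻ p, ENNReal.ofReal (c * g p) ∂μ ≤ ∫⁻ p, ENNReal.ofReal (A j p + B j p) ∂μ) :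
    ENNReal.ofReal (d * c) * ∫⁻ p, ENNReal.ofReal (g p) ∂μ ≤
      (∫⁻ p, ENNReal.ofReal (∑ j, A j p) ∂μ) + ∫⁻ p, ENNReal.ofReal (∑ j, B j p) ∂μ := by
  have hsum := Finset.sum_le_sum fun j (_ : j ∈ Finset.univ) => hle j
  rw [← lintegral_add_left (by fun_prop)]
  calc ENNReal.ofReal (d * c) * ∫⁻ p, ENNReal.ofReal (g p) ∂μ
      = ∑ _j : Fin d, ∫⁻ p, ENNReal.ofReal (c * g p) ∂μ := by
        simp only [ENNReal.ofReal_mul hc, ENNReal.ofReal_mul (Nat.cast_nonneg d),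
          ENNReal.ofReal_natCast, Finset.sum_const, Finset.card_univ, Fintype.card_fin,
          nsmul_eq_mul]
        rw [lintegral_const_mul _ (by fun_prop), mul_assoc]
    _ ≤ _ := hsum
    _ = _ := by
        rw [← lintegral_finsetSum _ fun j _ => by fun_prop]
        refine lintegral_congr fun p => ?_
        rw [← ENNReal.ofReal_sum_of_nonneg fun j _ => add_nonneg (hA0 j p) (hB0 j p),
          Finset.sum_add_distrib,
          ENNReal.ofReal_add (Finset.sum_nonneg fun j _ => hA0 j p)
            (Finset.sum_nonneg fun j _ => hB0 j p)]

/-- Heisenberg-type lower bounds: `C ≥ 2dℏ` on `L²(ℝᵈ × ℝᵈ)` and `c(x,ξ) ≥ dℏ` on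
`L²(ℝᵈ)`, in the sense of quadratic forms. -/
theorem stmt13 (d : ℕ) (hbar : ℝ) (hhbar : 0 < hbar) :
    (∀ Ψ : (Fin d → ℝ) × (Fin d → ℝ) → ℂ, Differentiable ℝ Ψ →
      ENNReal.ofReal (2 * d * hbar) * (∫⁻ p, ENNReal.ofReal (‖Ψ p‖ ^ 2)) ≤
        quantumCostForm d hbar Ψ) ∧
    (∀ (x ξ : Fin d → ℝ) (ψ : (Fin d → ℝ) → ℂ), Differentiable ℝ ψ →
      ENNReal.ofReal (d * hbar) * (∫⁻ z, ENNReal.ofReal (‖ψ z‖ ^ 2)) ≤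
        costForm d hbar x ξ ψ) := by
  constructor
  · intro Ψ hΨ
    have hΨm : Measurable Ψ := hΨ.continuous.measurable
    have hDm := measurable_fderiv_apply_const ℝ Ψ
    have hrw : 2 * (d : ℝ) * hbar = d * (2 * hbar) := by ring
    simp only [quantumCostForm, Finset.sum_mul, hrw]
    refine ofReal_nat_mul_lintegral_le (by positivity) (by fun_prop) (fun j => by fun_prop)
      (fun j => ?_) (fun j p => by positivity) (fun j p => by positivity) fun j => ?_
    · exact (((hDm _).sub (hDm _)).norm.pow_const 2).const_mul _
    let l : (Fin d → ℝ) × (Fin d → ℝ) →L[ℝ] ℝ :=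
      (ContinuousLinearMap.proj j).comp (ContinuousLinearMap.fst ℝ _ _) -
        (ContinuousLinearMap.proj j).comp (ContinuousLinearMap.snd ℝ _ _)
    have hl : ∀ p, l p = p.1 j - p.2 j := fun p => rfl
    let v : (Fin d → ℝ) × (Fin d → ℝ) :=
      (2⁻¹ : ℝ) • ((Pi.single j 1, 0) - (0, Pi.single j 1))
    have hlv : l v = 1 := by
      rw [hl]
      simp [v]
      norm_num
    have : (volume : Measure ((Fin d → ℝ) × (Fin d → ℝ))).IsAddLeftInvariant :=
      inferInstanceAs (Measure.prod volume volume).IsAddLeftInvariant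
    have := lintegral_norm_sq_le_directional (μ := volume) hlv
      (h := 2 * hbar) (by positivity) 0 0 hΨ
    refine this.trans_eq (lintegral_congr fun p => ?_)
    congr 2
    · rw [hl]; ring
    · have hv : ((0 : ℝ) : ℂ) * Ψ p + Complex.I * ((2 * hbar : ℝ) : ℂ) * fderiv ℝ Ψ p v =
          Complex.I * (hbar : ℂ) *
            (fderiv ℝ Ψ p (Pi.single j 1, 0) - fderiv ℝ Ψ p (0, Pi.single j 1)) := by
        simp only [v, map_smul, map_sub, Complex.real_smul]
        push_cast
        ring
      rw [hv, norm_mul, norm_mul, Complex.norm_I, one_mul, Complex.norm_real, mul_pow,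
        Real.norm_eq_abs, sq_abs]
  · intro x ξ ψ hψ
    have hψm : Measurable ψ := hψ.continuous.measurable
    have hDm : ∀ j, Measurable fun z => fderiv ℝ ψ z (Pi.single j 1) :=
      fun j => measurable_fderiv_apply_const ℝ ψ _
    simp only [costForm, Finset.sum_mul]
    refine ofReal_nat_mul_lintegral_le hhbar.le (by fun_prop) (fun j => by fun_prop)
      (fun j => ?_) (fun j p => by positivity) (fun j p => by positivity) fun j => ?_
    · have := hDm j
      fun_prop
    let l : (Fin d → ℝ) →L[ℝ] ℝ := ContinuousLinearMap.proj j
    have hlv : l (Pi.single j 1) = 1 := by simp [l]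
    exact lintegral_norm_sq_le_directional (μ := volume) hlv hhbar (x j) (ξ j) hψ
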